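/- arXiv:1107.1670 — 2 statements merged into one kernel-verified Lean document; each statement's English description precedes it below -/
import Mathlib

section
/- For every 1 ≤ p < ∞ there exists an entire function f : ℓ₁ → ℓ_p (complex Banach spaces) such that f is p-compact at 0, the Taylor polynomials P_mf(0) satisfy limsup_m κ_p(P_mf(0))^{1/m} = 1 (so the radius of p-compact convergence of f at 0 equals 1), but f is not p-compact at e₁, the first canonical basis vector of ℓ₁. -/
open scoped ENNReal NNReal Classical
open Filter Metric

noncomputable section

/-- Membership in the closed unit ball of `ℓ_q`, where `q` is the conjugate exponent of `p`
(`q = ∞`, i.e. bounded coefficients, when `p = 1`). -/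
def ConjUnitBall (p : ℝ) (α : ℕ → ℂ) : Prop :=
  if p = 1 then ∀ n, ‖α n‖ ≤ 1
  else (Summable fun n => ‖α n‖ ^ (p / (p - 1))) ∧ (∑' n, ‖α n‖ ^ (p / (p - 1))) ≤ 1

variable {E F : Type*} [NormedAddCommGroup E] [NormedSpace ℂ E]
  [NormedAddCommGroup F] [NormedSpace ℂ F]

/-- The `p`-convex hull `p-co{x_n}` of a sequence `(x_n)`. -/
def pCo (p : ℝ) (x : ℕ → F) : Set F :=
  {y | ∃ α : ℕ → ℂ, ConjUnitBall p α ∧ HasSum (fun n => α n • x n) y}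

/-- A set is relatively `p`-compact if it is contained in the `p`-convex hull of a
`p`-summable sequence. -/
def IsRelPCompact (p : ℝ) (K : Set F) : Prop :=
  ∃ x : ℕ → F, (Summable fun n => ‖x n‖ ^ p) ∧ K ⊆ pCo p x

/-- The measure of `p`-compactness `m_p(K)`. -/
def mP (p : ℝ) (K : Set F) : ℝ :=
  sInf {r : ℝ | ∃ x : ℕ → F, (Summable fun n => ‖x n‖ ^ p) ∧ K ⊆ pCo p x ∧
    r = (∑' n, ‖x n‖ ^ p) ^ (1 / p)}

/-- `m_p(K)` as an element of `[0, ∞]`; it equals `∞` when `K` is not relatively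
`p`-compact. -/
def mPE (p : ℝ) (K : Set F) : ℝ≥0∞ :=
  sInf {r : ℝ≥0∞ | ∃ x : ℕ → F, (Summable fun n => ‖x n‖ ^ p) ∧ K ⊆ pCo p x ∧
    r = ENNReal.ofReal ((∑' n, ‖x n‖ ^ p) ^ (1 / p))}

/-- The `m`-homogeneous polynomial `P_m f(x₀)` in the Taylor series expansion of `f` at `x₀`. -/
def taylorPoly (f : E → F) (x₀ : E) (m : ℕ) (x : E) : F :=
  ((m.factorial : ℂ))⁻¹ • iteratedFDeriv ℂ m f x₀ fun _ => x

/-- `f` is `p`-compact at `x₀` if some neighborhood of `x₀` has relatively `p`-compact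
image under `f`. -/
def PCompactAt (p : ℝ) (f : E → F) (x₀ : E) : Prop :=
  ∃ V ∈ nhds x₀, IsRelPCompact p (f '' V)

/-- The radius of `p`-compact convergence of `f` at `x₀`:
`r_p(f, x₀) = 1 / limsup κ_p(P_mf(x₀))^{1/m}` (with the conventions `1/0 = ∞`, and
`κ_p(P) = ∞` when `P` is not `p`-compact, so that `r_p(f,x₀) = 0` in that case). -/
def pRadius (p : ℝ) (f : E → F) (x₀ : E) : ℝ≥0∞ :=
  (Filter.limsup (fun m : ℕ => (mPE p (taylorPoly f x₀ m '' closedBall 0 1)) ^ (1 / (m : ℝ)))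
    Filter.atTop)⁻¹

instance (p : ℝ) [hp : Fact (1 ≤ p)] : Fact (1 ≤ ENNReal.ofReal p) :=
  ⟨by rw [← ENNReal.ofReal_one]; exact ENNReal.ofReal_le_ofReal hp.out⟩

/-! ### Diagonal sets and `p`-compactness in `ℓ_p` -/

lemma conjUnitBall_of_tsum_norm_le_one {p : ℝ} (hp : 1 ≤ p) {α : ℕ → ℂ}
    (hs : Summable fun n => ‖α n‖) (h : ∑' n, ‖α n‖ ≤ 1) : ConjUnitBall p α := by
  have h1 : ∀ n, ‖α n‖ ≤ 1 := fun n =>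
    (hs.le_tsum n fun _ _ => norm_nonneg _).trans h
  unfold ConjUnitBall
  split_ifs with hp1
  · exact h1
  · have hp' : 1 < p := lt_of_le_of_ne hp (Ne.symm hp1)
    have hq : 1 ≤ p / (p - 1) := by
      rw [le_div_iff₀ (by linarith)]; linarith
    have hle : ∀ n, ‖α n‖ ^ (p / (p - 1)) ≤ ‖α n‖ := fun n => by
      simpa using Real.rpow_le_rpow_of_exponent_ge' (norm_nonneg _) (h1 n) zero_le_one hq
    have hsq : Summable fun n => ‖α n‖ ^ (p / (p - 1)) :=
      Summable.of_nonneg_of_le (fun n => by positivity) hle hs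
    exact ⟨hsq, (hsq.tsum_le_tsum hle hs).trans h⟩

/-- Hölder's inequality for coefficients in the unit ball of `ℓ_q`. -/
lemma ConjUnitBall.norm_rpow_le {p : ℝ} (hp : 1 ≤ p) {α a : ℕ → ℂ} {s : ℂ}
    (hα : ConjUnitBall p α) (ha : Summable fun n => ‖a n‖ ^ p)
    (hs : HasSum (fun n => α n * a n) s) : ‖s‖ ^ p ≤ ∑' n, ‖a n‖ ^ p := by
  unfold ConjUnitBall at hα
  split_ifs at hα with hp1
  · subst hp1
    simp only [Real.rpow_one] at ha ⊢
    have hle : ∀ n, ‖α n * a n‖ ≤ ‖a n‖ := fun n => by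
      rw [norm_mul]
      exact mul_le_of_le_one_left (norm_nonneg _) (hα n)
    have hsum : Summable fun n => ‖α n * a n‖ :=
      Summable.of_nonneg_of_le (fun n => norm_nonneg _) hle ha
    rw [← hs.tsum_eq]
    exact (norm_tsum_le_tsum_norm hsum).trans (hsum.tsum_le_tsum hle ha)
  · have hp' : 1 < p := lt_of_le_of_ne hp (Ne.symm hp1)
    have hpq : (p / (p - 1)).HolderConjugate p :=
      (Real.HolderConjugate.conjExponent hp').symm
    obtain ⟨hsum, hle⟩ := Real.summable_and_inner_le_Lp_mul_Lq_tsum_of_nonneg hpq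
      (fun n => norm_nonneg (α n)) (fun n => norm_nonneg (a n)) hα.1 ha
    have hnn : 0 ≤ ∑' n, ‖a n‖ ^ p := tsum_nonneg fun n => by positivity
    have h1 : ‖s‖ ≤ (∑' n, ‖a n‖ ^ p) ^ (1 / p) := by
      rw [← hs.tsum_eq]
      refine (norm_tsum_le_tsum_norm (by simpa only [norm_mul] using hsum)).trans ?_
      simp only [norm_mul]
      refine hle.trans (mul_le_of_le_one_left (by positivity) ?_)
      exact Real.rpow_le_one (tsum_nonneg fun n => by positivity) hα.2
        (by have := hpq.pos; positivity)
    calc ‖s‖ ^ p ≤ ((∑' n, ‖a n‖ ^ p) ^ (1 / p)) ^ p :=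
          Real.rpow_le_rpow (norm_nonneg _) h1 (by linarith)
      _ = ∑' n, ‖a n‖ ^ p := by
          rw [← Real.rpow_mul hnn, one_div, inv_mul_cancel₀ (by linarith), Real.rpow_one]

/-- Evaluation of a sequence in `ℓ_r` at a coordinate, as a continuous linear functional. -/
def lpCoord (r : ℝ≥0∞) [Fact (1 ≤ r)] (j : ℕ) : lp (fun _ : ℕ => ℂ) r →L[ℂ] ℂ :=
  LinearMap.mkContinuous
    { toFun := fun x => x j
      map_add' := fun _ _ => rfl
      map_smul' := fun _ _ => rfl } 1 fun x => by
    rw [one_mul]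
    exact lp.norm_apply_le_norm (zero_lt_one.trans_le (Fact.out : 1 ≤ r)).ne' x j

@[simp] lemma lpCoord_apply (r : ℝ≥0∞) [Fact (1 ≤ r)] (j : ℕ) (x : lp (fun _ : ℕ => ℂ) r) :
    lpCoord r j x = x j := rfl

lemma norm_lpCoord_le (r : ℝ≥0∞) [Fact (1 ≤ r)] (j : ℕ) : ‖lpCoord r j‖ ≤ 1 :=
  LinearMap.mkContinuous_norm_le _ zero_le_one _

lemma norm_lpSingle (p : ℝ) [hp : Fact (1 ≤ p)] (j : ℕ) (z : ℂ) :
    ‖(lp.single (ENNReal.ofReal p) j z : lp (fun _ : ℕ => ℂ) (ENNReal.ofReal p))‖ = ‖z‖ :=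
  lp.norm_single (E := fun _ : ℕ => ℂ)
    (ENNReal.ofReal_pos.2 (zero_lt_one.trans_le hp.out)) j z

/-- A set of sequences dominated coordinatewise by a `p`-summable sequence, with coefficients in
the unit ball of `ℓ_1`, lies in the `p`-convex hull of a diagonal sequence. -/
lemma subset_pCo_single {p : ℝ} [hp : Fact (1 ≤ p)]
    {K : Set (lp (fun _ : ℕ => ℂ) (ENNReal.ofReal p))} {t : ℕ → ℂ}
    (h : ∀ y ∈ K, ∃ α : ℕ → ℂ, (Summable fun n => ‖α n‖) ∧ ∑' n, ‖α n‖ ≤ 1 ∧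
      ∀ j, y j = α j * t j) :
    K ⊆ pCo p fun j => (lp.single (ENNReal.ofReal p) j (t j) :
      lp (fun _ : ℕ => ℂ) (ENNReal.ofReal p)) := by
  intro y hy
  obtain ⟨α, hs, h1, hα⟩ := h y hy
  refine ⟨α, conjUnitBall_of_tsum_norm_le_one hp.out hs h1, ?_⟩
  have := lp.hasSum_single (E := fun _ : ℕ => ℂ) ENNReal.ofReal_ne_top y
  convert this using 2 with j
  rw [hα j, ← smul_eq_mul, lp.single_smul]

/-- If a set in the `p`-convex hull of `x` contains, for each `j ∈ S`, a sequence whose `j`-th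
coordinate is at least `t j`, then the `p`-sum of `t` over `S` is controlled by `x`. -/
lemma sum_rpow_le_of_subset_pCo {p : ℝ} [hp : Fact (1 ≤ p)]
    {K : Set (lp (fun _ : ℕ => ℂ) (ENNReal.ofReal p))}
    {x : ℕ → lp (fun _ : ℕ => ℂ) (ENNReal.ofReal p)} (hx : Summable fun n => ‖x n‖ ^ p)
    (hK : K ⊆ pCo p x) {t : ℕ → ℝ} (ht : ∀ j, 0 ≤ t j) (S : Finset ℕ)
    (h : ∀ j ∈ S, ∃ y ∈ K, t j ≤ ‖y j‖) :
    ∑ j ∈ S, t j ^ p ≤ ∑' n, ‖x n‖ ^ p := by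
  have hp0 : 0 < p := zero_lt_one.trans_le hp.out
  have hpr : (ENNReal.ofReal p).toReal = p := ENNReal.toReal_ofReal hp0.le
  have hcoord : ∀ j n, ‖x n j‖ ^ p ≤ ‖x n‖ ^ p := fun j n =>
    Real.rpow_le_rpow (norm_nonneg _)
      (lp.norm_apply_le_norm (ENNReal.ofReal_pos.2 hp0).ne' (x n) j) hp0.le
  have hsum : ∀ j, Summable fun n => ‖x n j‖ ^ p := fun j =>
    Summable.of_nonneg_of_le (fun n => by positivity) (hcoord j) hx
  calc ∑ j ∈ S, t j ^ p ≤ ∑ j ∈ S, ∑' n, ‖x n j‖ ^ p := by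
        refine Finset.sum_le_sum fun j hj => ?_
        obtain ⟨y, hy, hty⟩ := h j hj
        obtain ⟨α, hα, hs⟩ := hK hy
        refine (Real.rpow_le_rpow (ht j) hty hp0.le).trans ?_
        refine hα.norm_rpow_le hp.out (hsum j) ?_
        simpa using (lpCoord (ENNReal.ofReal p) j).hasSum hs
    _ = ∑' n, ∑ j ∈ S, ‖x n j‖ ^ p := (Summable.tsum_finsetSum fun j _ => hsum j).symm
    _ ≤ ∑' n, ‖x n‖ ^ p := by
        refine Summable.tsum_le_tsum (fun n => ?_) (summable_sum fun j _ => hsum j) hx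
        simpa only [hpr] using
          lp.sum_rpow_le_norm_rpow (by rwa [hpr]) (x n) S

/-! ### Power series of the form `∑ φ(x)^m T_m(x)` -/

/-- The multilinear map `(v₀, …, v_m) ↦ φ(v₁) ⋯ φ(v_m) T(v₀)`. -/
def powSmulMultilinear (φ : E →L[ℂ] ℂ) (T : E →L[ℂ] F) (m : ℕ) :
    ContinuousMultilinearMap ℂ (fun _ : Fin (m + 1) => E) F :=
  ContinuousLinearMap.uncurryLeft
    ((ContinuousMultilinearMap.smulRightL ℂ (fun _ : Fin m => E) F
      ((ContinuousMultilinearMap.mkPiAlgebra ℂ (Fin m) ℂ).compContinuousLinearMap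
        fun _ => φ)).comp T)

lemma powSmulMultilinear_apply (φ : E →L[ℂ] ℂ) (T : E →L[ℂ] F) (m : ℕ) (v : Fin (m + 1) → E) :
    powSmulMultilinear φ T m v = (∏ i : Fin m, φ (v i.succ)) • T (v 0) := by
  simp [powSmulMultilinear, ContinuousLinearMap.uncurryLeft_apply, Fin.tail]

lemma norm_powSmulMultilinear_le {φ : E →L[ℂ] ℂ} (hφ : ‖φ‖ ≤ 1) {T : E →L[ℂ] F} {C : ℝ}
    (hC : ‖T‖ ≤ C) (m : ℕ) : ‖powSmulMultilinear φ T m‖ ≤ C := by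
  have hC0 : 0 ≤ C := (norm_nonneg _).trans hC
  refine ContinuousMultilinearMap.opNorm_le_bound hC0 fun v => ?_
  rw [powSmulMultilinear_apply, norm_smul, norm_prod, Fin.prod_univ_succ, mul_left_comm, mul_comm,
    ← mul_assoc, mul_comm _ C, mul_assoc]
  have h1 : ∏ i : Fin m, ‖φ (v i.succ)‖ ≤ ∏ i : Fin m, ‖v i.succ‖ :=
    Finset.prod_le_prod (fun _ _ => norm_nonneg _) fun i _ => by
      simpa using φ.le_of_opNorm_le hφ (v i.succ)
  have h2 := T.le_of_opNorm_le hC (v 0)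
  calc _ ≤ (C * ‖v 0‖) * ∏ i : Fin m, ‖v i.succ‖ := by gcongr
    _ = _ := by ring

/-- The formal power series `∑ φ(x)^m T_m(x)`. -/
def powSmulSeries (φ : E →L[ℂ] ℂ) (T : ℕ → E →L[ℂ] F) : FormalMultilinearSeries ℂ E F
  | 0 => 0
  | m + 1 => powSmulMultilinear φ (T m) m

lemma powSmulSeries_zero_apply (φ : E →L[ℂ] ℂ) (T : ℕ → E →L[ℂ] F) (x : E) :
    (powSmulSeries φ T 0 fun _ => x) = 0 := rfl

lemma powSmulSeries_succ_apply (φ : E →L[ℂ] ℂ) (T : ℕ → E →L[ℂ] F) (m : ℕ) (x : E) :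
    (powSmulSeries φ T (m + 1) fun _ => x) = φ x ^ m • T m x := by
  simp [powSmulSeries, powSmulMultilinear_apply]

lemma radius_powSmulSeries {φ : E →L[ℂ] ℂ} (hφ : ‖φ‖ ≤ 1) {T : ℕ → E →L[ℂ] F}
    (hT : ∀ m, ‖T m‖ ≤ 1 / (m.factorial : ℝ)) : (powSmulSeries φ T).radius = ⊤ := by
  refine FormalMultilinearSeries.radius_eq_top_of_summable_norm _ fun r => ?_
  rw [← summable_nat_add_iff 1]
  refine Summable.of_nonneg_of_le (fun m => by positivity) (fun m => ?_)
    ((Real.summable_pow_div_factorial r).mul_left (r : ℝ))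
  calc ‖powSmulSeries φ T (m + 1)‖ * (r : ℝ) ^ (m + 1)
      ≤ 1 / (m.factorial : ℝ) * (r : ℝ) ^ (m + 1) := by
        gcongr
        exact norm_powSmulMultilinear_le hφ (hT m) m
    _ = r * ((r : ℝ) ^ m / m.factorial) := by ring

/-! ### The block construction -/

section Blocks

variable {N : ℕ → ℕ}

/-- The indices in the blocks numbered by `A`. -/
def blockIndices (e : ℕ ≃ Σ m, Fin (N m)) (A : Finset ℕ) : Finset ℕ :=
  (A.sigma fun _ => Finset.univ).map e.symm.toEmbedding

lemma mem_blockIndices (e : ℕ ≃ Σ m, Fin (N m)) (A : Finset ℕ) (j : ℕ) :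
    j ∈ blockIndices e A ↔ (e j).1 ∈ A := by
  simp only [blockIndices, Finset.mem_map_equiv, Equiv.symm_symm, Finset.mem_sigma,
    Finset.mem_univ, and_true]

lemma sum_blockIndices (e : ℕ ≃ Σ m, Fin (N m)) (A : Finset ℕ) (g : ℕ → ℝ) :
    ∑ j ∈ blockIndices e A, g (e j).1 = ∑ m ∈ A, N m * g m := by
  simp [blockIndices, Finset.sum_map, Finset.sum_sigma]

lemma summable_of_block (e : ℕ ≃ Σ m, Fin (N m)) {g : ℕ → ℝ} (hg : ∀ m, 0 ≤ g m)
    (h : Summable fun m => N m * g m) : Summable fun j => g (e j).1 := by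
  refine (e.summable_iff (f := fun i : Σ m, Fin (N m) => g i.1)).2 ?_
  rw [summable_sigma_of_nonneg fun i => hg i.1]
  exact ⟨fun m => (hasSum_fintype _).summable, by simpa using h⟩

/-- The operator `ℓ₁ → ℓ_p` sending `x` to `c m` times the restriction of the left shift of `x` to
the `m`-th block. -/
def blockMap (p : ℝ) [Fact (1 ≤ p)] (e : ℕ ≃ Σ m, Fin (N m)) (c : ℕ → ℝ) (m : ℕ) :
    lp (fun _ : ℕ => ℂ) 1 →L[ℂ] lp (fun _ : ℕ => ℂ) (ENNReal.ofReal p) :=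
  ∑ j ∈ blockIndices e {m}, (lpCoord 1 (j + 1)).smulRight
    (lp.single (ENNReal.ofReal p) j (c m : ℂ) : lp (fun _ : ℕ => ℂ) (ENNReal.ofReal p))

lemma blockMap_apply_eq_sum (p : ℝ) [Fact (1 ≤ p)] (e : ℕ ≃ Σ m, Fin (N m)) (c : ℕ → ℝ) (m : ℕ)
    (x : lp (fun _ : ℕ => ℂ) 1) :
    blockMap p e c m x = ∑ j ∈ blockIndices e {m}, x (j + 1) •
      (lp.single (ENNReal.ofReal p) j (c m : ℂ) : lp (fun _ : ℕ => ℂ) (ENNReal.ofReal p)) := by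
  simp [blockMap]

lemma blockMap_apply (p : ℝ) [Fact (1 ≤ p)] (e : ℕ ≃ Σ m, Fin (N m)) (c : ℕ → ℝ) (m : ℕ)
    (x : lp (fun _ : ℕ => ℂ) 1) (k : ℕ) :
    blockMap p e c m x k = if (e k).1 = m then c m * x (k + 1) else 0 := by
  rw [blockMap_apply_eq_sum, lp.coeFn_sum, Finset.sum_apply]
  simp only [lp.coeFn_smul, Pi.smul_apply, lp.single_apply, Pi.single_apply, smul_eq_mul, mul_ite,
    mul_zero, Finset.sum_ite_eq, mem_blockIndices, Finset.mem_singleton]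
  rw [mul_comm]

lemma sum_norm_le_norm (x : lp (fun _ : ℕ => ℂ) 1) (S : Finset ℕ) :
    ∑ j ∈ S, ‖x j‖ ≤ ‖x‖ := by
  simpa using lp.sum_rpow_le_norm_rpow (p := 1) (by simp) x S

lemma sum_norm_succ_le_norm (x : lp (fun _ : ℕ => ℂ) 1) (S : Finset ℕ) :
    ∑ j ∈ S, ‖x (j + 1)‖ ≤ ‖x‖ := by
  simpa using sum_norm_le_norm x (S.map (addRightEmbedding 1))

lemma norm_blockMap_le (p : ℝ) [Fact (1 ≤ p)] (e : ℕ ≃ Σ m, Fin (N m)) {c : ℕ → ℝ}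
    (hc : ∀ m, 0 ≤ c m) (m : ℕ) : ‖blockMap p e c m‖ ≤ c m := by
  refine ContinuousLinearMap.opNorm_le_bound _ (hc m) fun x => ?_
  rw [blockMap_apply_eq_sum]
  refine (norm_sum_le _ _).trans ?_
  simp only [norm_smul, norm_lpSingle, Complex.norm_real, Real.norm_of_nonneg (hc m)]
  rw [← Finset.sum_mul, mul_comm]
  exact mul_le_mul_of_nonneg_left (sum_norm_succ_le_norm x _) (hc m)

/-- The Taylor series at the origin of `x ↦ (x₀ ^ m(j) c_{m(j)} x_{j+1})_j`, where `m(j)` is the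
block of `j`. -/
def blockSeries (p : ℝ) [Fact (1 ≤ p)] (e : ℕ ≃ Σ m, Fin (N m)) (c : ℕ → ℝ) :
    FormalMultilinearSeries ℂ (lp (fun _ : ℕ => ℂ) 1) (lp (fun _ : ℕ => ℂ) (ENNReal.ofReal p)) :=
  powSmulSeries (lpCoord 1 0) (blockMap p e c)

lemma blockSeries_succ_apply (p : ℝ) [Fact (1 ≤ p)] (e : ℕ ≃ Σ m, Fin (N m)) (c : ℕ → ℝ) (m : ℕ)
    (x : lp (fun _ : ℕ => ℂ) 1) (j : ℕ) :
    (blockSeries p e c (m + 1) fun _ => x) j =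
      if (e j).1 = m then x 0 ^ m * (c m * x (j + 1)) else 0 := by
  rw [blockSeries, powSmulSeries_succ_apply]
  simp [blockMap_apply]

variable {p : ℝ} [hp : Fact (1 ≤ p)] {e : ℕ ≃ Σ m, Fin (N m)} {c : ℕ → ℝ}

lemma hasFPowerSeriesOnBall_blockSeries (hc : ∀ m, 0 ≤ c m)
    (hc' : ∀ m, c m ≤ 1 / (m.factorial : ℝ)) :
    HasFPowerSeriesOnBall (blockSeries p e c).sum (blockSeries p e c) 0 ⊤ := by
  have hr : (blockSeries p e c).radius = ⊤ := radius_powSmulSeries (norm_lpCoord_le 1 0)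
    fun m => (norm_blockMap_le p e hc m).trans (hc' m)
  have := (blockSeries p e c).hasFPowerSeriesOnBall (by simp [hr])
  rwa [hr] at this

lemma blockSeries_sum_apply (hc : ∀ m, 0 ≤ c m)
    (hc' : ∀ m, c m ≤ 1 / (m.factorial : ℝ)) (x : lp (fun _ : ℕ => ℂ) 1) (j : ℕ) :
    (blockSeries p e c).sum x j = x 0 ^ (e j).1 * (c (e j).1 * x (j + 1)) := by
  have h := (hasFPowerSeriesOnBall_blockSeries (p := p) (e := e) hc hc').hasSum
    (y := x) (by simp)
  rw [zero_add] at h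
  refine ((lpCoord (ENNReal.ofReal p) j).hasSum h).unique ?_
  convert hasSum_single ((e j).1 + 1) ?_ using 1
  · simp [blockSeries_succ_apply]
  · rintro (_ | m) hm
    · rfl
    · simp only [lpCoord_apply, blockSeries_succ_apply]
      rw [if_neg (by omega)]

lemma taylorPoly_blockSeries_sum (hc : ∀ m, 0 ≤ c m)
    (hc' : ∀ m, c m ≤ 1 / (m.factorial : ℝ)) (n : ℕ) (x : lp (fun _ : ℕ => ℂ) 1) :
    taylorPoly (blockSeries p e c).sum 0 n x = blockSeries p e c n fun _ => x := by
  rw [taylorPoly,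
    ← (hasFPowerSeriesOnBall_blockSeries (p := p) (e := e) hc hc').factorial_smul x n,
    ← Nat.cast_smul_eq_nsmul ℂ, smul_smul,
    inv_mul_cancel₀ (by exact_mod_cast n.factorial_ne_zero), one_smul]

lemma exists_coeff_summable {x : lp (fun _ : ℕ => ℂ) 1} (hx : ‖x‖ ≤ 1) {α : ℕ → ℂ}
    (hα : ∀ j, ‖α j‖ ≤ ‖x (j + 1)‖) : (Summable fun n => ‖α n‖) ∧ ∑' n, ‖α n‖ ≤ 1 := by
  have h : ∀ S : Finset ℕ, ∑ n ∈ S, ‖α n‖ ≤ 1 := fun S =>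
    (Finset.sum_le_sum fun j _ => hα j).trans ((sum_norm_succ_le_norm x S).trans hx)
  have hs := summable_of_sum_le (fun n => norm_nonneg (α n)) h
  exact ⟨hs, hs.tsum_le_of_sum_le h⟩

lemma pCompactAt_zero_blockSeries_sum (hc : ∀ m, 0 ≤ c m)
    (hc' : ∀ m, c m ≤ 1 / (m.factorial : ℝ)) (hN : ∀ m, N m * c m ^ p = 1) :
    PCompactAt p (blockSeries p e c).sum 0 := by
  refine ⟨ball 0 (1 / 2), ball_mem_nhds _ (by norm_num), _, ?_, subset_pCo_single
    (t := fun j => (((1 / 2 : ℝ) ^ (e j).1 * c (e j).1 : ℝ) : ℂ)) ?_⟩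
  · have hp0 : 0 < p := zero_lt_one.trans_le hp.out
    simp only [norm_lpSingle, Complex.norm_real]
    have hnn : ∀ m, 0 ≤ (1 / 2 : ℝ) ^ m * c m := fun m => mul_nonneg (by positivity) (hc m)
    refine summable_of_block e (g := fun m => ‖(1 / 2 : ℝ) ^ m * c m‖ ^ p)
      (fun m => by positivity) ?_
    have hgeo : Summable fun m : ℕ => ((1 / 2 : ℝ) ^ p) ^ m :=
      summable_geometric_of_lt_one (by positivity)
        (Real.rpow_lt_one (by norm_num) (by norm_num) hp0)
    refine hgeo.congr fun m => ?_
    rw [Real.norm_of_nonneg (hnn m), Real.mul_rpow (by positivity) (hc m), mul_left_comm, hN m,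
      mul_one, ← Real.rpow_natCast, ← Real.rpow_natCast, ← Real.rpow_mul (by norm_num),
      ← Real.rpow_mul (by norm_num), mul_comm]
  · rintro _ ⟨x, hx, rfl⟩
    have hx' : ‖x‖ < 1 / 2 := by simpa using hx
    have hx0 : ‖2 * x 0‖ ≤ 1 := by
      have := lp.norm_apply_le_norm one_ne_zero x 0
      rw [norm_mul, Complex.norm_ofNat]
      linarith
    refine ⟨fun j => (2 * x 0) ^ (e j).1 * x (j + 1), ?_⟩
    rw [← and_assoc]
    refine ⟨exists_coeff_summable (x := x) (by linarith) fun j => ?_, fun j => ?_⟩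
    · rw [norm_mul, norm_pow]
      exact mul_le_of_le_one_left (norm_nonneg _) (pow_le_one₀ (norm_nonneg _) hx0)
    · rw [blockSeries_sum_apply hc hc']
      push_cast
      rw [mul_pow]
      have : (2 : ℂ) ^ (e j).1 * (1 / 2) ^ (e j).1 = 1 := by rw [← mul_pow]; norm_num
      linear_combination (-(x 0 ^ (e j).1 * (c (e j).1 * x (j + 1)))) * this

lemma norm_single_one (j : ℕ) (z : ℂ) :
    ‖(lp.single 1 j z : lp (fun _ : ℕ => ℂ) 1)‖ = ‖z‖ :=
  lp.norm_single (E := fun _ : ℕ => ℂ) zero_lt_one j z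

lemma not_pCompactAt_single_blockSeries_sum (hc : ∀ m, 0 ≤ c m)
    (hc' : ∀ m, c m ≤ 1 / (m.factorial : ℝ)) (hN : ∀ m, N m * c m ^ p = 1) :
    ¬ PCompactAt p (blockSeries p e c).sum (lp.single 1 0 (1 : ℂ)) := by
  rintro ⟨V, hV, x, hx, hK⟩
  obtain ⟨ε, hε, hball⟩ := Metric.mem_nhds_iff.1 hV
  have hδ : 0 < ε / 2 := by positivity
  have key : ∀ M : ℕ, M * (ε / 2) ^ p ≤ ∑' n, ‖x n‖ ^ p := fun M => by
    have h := sum_rpow_le_of_subset_pCo hx hK (t := fun j => ε / 2 * c (e j).1)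
      (fun j => mul_nonneg hδ.le (hc _)) (blockIndices e (Finset.range M)) fun j _ =>
      ⟨_, ⟨lp.single 1 0 (1 : ℂ) + lp.single 1 (j + 1) ((ε / 2 : ℝ) : ℂ), hball ?_, rfl⟩, ?_⟩
    · rw [sum_blockIndices e _ fun m => (ε / 2 * c m) ^ p] at h
      refine le_of_eq_of_le ?_ h
      have : ∀ m, N m * (ε / 2 * c m) ^ p = (ε / 2) ^ p := fun m => by
        rw [Real.mul_rpow hδ.le (hc m), mul_left_comm, hN m, mul_one]
      simp [this]
    · rw [mem_ball, dist_eq_norm, add_sub_cancel_left, norm_single_one, Complex.norm_real,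
        Real.norm_of_nonneg hδ.le]
      linarith
    · rw [blockSeries_sum_apply hc hc']
      simp [abs_of_nonneg (hc _), abs_of_pos hε, mul_comm]
  obtain ⟨M, hM⟩ := exists_nat_gt ((∑' n, ‖x n‖ ^ p) / (ε / 2) ^ p)
  rw [div_lt_iff₀ (by positivity)] at hM
  exact (key M).not_gt hM

lemma mPE_blockSeries_le_one (hc : ∀ m, 0 ≤ c m) (hN : ∀ m, N m * c m ^ p = 1) (m : ℕ) :
    mPE p ((fun x => blockSeries p e c (m + 1) fun _ => x) '' closedBall 0 1) ≤ 1 := by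
  have hp0 : 0 < p := zero_lt_one.trans_le hp.out
  have hsum : HasSum (fun j => ‖(lp.single (ENNReal.ofReal p) j
      ((if (e j).1 = m then c m else 0 : ℝ) : ℂ) :
      lp (fun _ : ℕ => ℂ) (ENNReal.ofReal p))‖ ^ p) 1 := by
    simp only [norm_lpSingle, Complex.norm_real]
    have h := sum_blockIndices e {m} fun k => ‖(if k = m then c m else 0 : ℝ)‖ ^ p
    rw [Finset.sum_singleton, if_pos rfl, Real.norm_of_nonneg (hc m), hN m] at h
    rw [← h]
    refine hasSum_sum_of_ne_finset_zero fun j hj => ?_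
    rw [mem_blockIndices, Finset.mem_singleton] at hj
    simp [hj, Real.zero_rpow hp0.ne']
  refine sInf_le ⟨_, hsum.summable, subset_pCo_single ?_, ?_⟩
  · rintro _ ⟨x, hx, rfl⟩
    have hx' : ‖x‖ ≤ 1 := by simpa using hx
    refine ⟨fun j => x 0 ^ m * x (j + 1), ?_⟩
    rw [← and_assoc]
    refine ⟨exists_coeff_summable hx' fun j => ?_, fun j => ?_⟩
    · rw [norm_mul, norm_pow]
      exact mul_le_of_le_one_left (norm_nonneg _) (pow_le_one₀ (norm_nonneg _)
        ((lp.norm_apply_le_norm one_ne_zero x 0).trans hx'))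
    · simp only [blockSeries_succ_apply]
      split_ifs
      · ring
      · simp
  · rw [hsum.tsum_eq]
    simp

lemma le_mPE_blockSeries (hc : ∀ m, 0 ≤ c m) (hN : ∀ m, N m * c m ^ p = 1) (m : ℕ) {s : ℝ}
    (hs0 : 0 ≤ s) (hs1 : s ≤ 1) :
    ENNReal.ofReal ((1 - s) ^ m * s) ≤
      mPE p ((fun x => blockSeries p e c (m + 1) fun _ => x) '' closedBall 0 1) := by
  have hp0 : 0 < p := zero_lt_one.trans_le hp.out
  have h1s : 0 ≤ 1 - s := by linarith
  have ha : 0 ≤ (1 - s) ^ m * s := by positivity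
  refine le_sInf ?_
  rintro _ ⟨x, hx, hK, rfl⟩
  have h := sum_rpow_le_of_subset_pCo hx hK (t := fun j => (1 - s) ^ m * s * c (e j).1)
    (fun j => mul_nonneg ha (hc _)) (blockIndices e {m}) fun j hj =>
    ⟨_, ⟨lp.single 1 0 ((1 - s : ℝ) : ℂ) + lp.single 1 (j + 1) (s : ℂ), ?_, rfl⟩, ?_⟩
  · rw [sum_blockIndices e _ fun k => ((1 - s) ^ m * s * c k) ^ p, Finset.sum_singleton,
      Real.mul_rpow ha (hc m), mul_left_comm, hN m, mul_one] at h
    refine ENNReal.ofReal_le_ofReal ?_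
    rw [one_div]
    exact (Real.le_rpow_inv_iff_of_pos ha (tsum_nonneg fun n => by positivity) hp0).2 h
  · rw [mem_closedBall_zero_iff]
    refine (norm_add_le _ _).trans ?_
    rw [norm_single_one, norm_single_one, Complex.norm_real, Complex.norm_real,
      Real.norm_of_nonneg h1s, Real.norm_of_nonneg hs0]
    linarith
  · rw [mem_blockIndices, Finset.mem_singleton] at hj
    have hn : ‖(1 - s : ℂ)‖ = 1 - s := by
      rw [← Complex.ofReal_one, ← Complex.ofReal_sub, Complex.norm_real, Real.norm_of_nonneg h1s]
    refine le_of_eq ?_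
    simp [blockSeries_succ_apply, hj, abs_of_nonneg (hc _), abs_of_nonneg hs0, hn]
    ring

lemma tendsto_mPE_rpow (hc : ∀ m, 0 ≤ c m) (hN : ∀ m, N m * c m ^ p = 1) :
    Tendsto (fun n : ℕ => mPE p ((fun x => blockSeries p e c n fun _ => x) '' closedBall 0 1) ^
      (1 / (n : ℝ))) atTop (nhds 1) := by
  have hlow : Tendsto (fun n : ℕ => (1 - 1 / (n : ℝ)) * ((n : ℝ) ^ (1 / (n : ℝ)))⁻¹)
      atTop (nhds 1) := by
    have h1 : Tendsto (fun n : ℕ => 1 - 1 / (n : ℝ)) atTop (nhds 1) := by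
      simpa using tendsto_one_div_atTop_nhds_zero_nat.const_sub (1 : ℝ)
    simpa using h1.mul ((tendsto_rpow_div.comp tendsto_natCast_atTop_atTop).inv₀ one_ne_zero)
  have hlow' := ENNReal.tendsto_ofReal hlow
  rw [ENNReal.ofReal_one] at hlow'
  refine tendsto_of_tendsto_of_tendsto_of_le_of_le' hlow' tendsto_const_nhds ?_ ?_
  · filter_upwards [eventually_ge_atTop 1] with n hn
    obtain ⟨m, rfl⟩ := Nat.exists_eq_add_of_le' hn
    set n : ℝ := ((m + 1 : ℕ) : ℝ) with hndef
    have hn1 : 1 ≤ n := by rw [hndef]; exact_mod_cast hn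
    have hn0 : 0 < n := by linarith
    have hi1 : 1 / n ≤ 1 := by rw [div_le_one hn0]; exact hn1
    have h0 : 0 ≤ 1 - 1 / n := by linarith
    have h := le_mPE_blockSeries (e := e) hc hN m (by positivity) hi1
    refine le_trans ?_ (ENNReal.rpow_le_rpow h (by positivity))
    rw [ENNReal.ofReal_rpow_of_nonneg (by positivity) (by positivity)]
    refine ENNReal.ofReal_le_ofReal ?_
    have h2 : (1 - 1 / n) ^ (m + 1) * (1 / n) ≤ (1 - 1 / n) ^ m * (1 / n) := by
      gcongr ?_ * _
      exact pow_le_pow_of_le_one h0 (by linarith [show 0 < 1 / n by positivity]) m.le_succ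
    refine le_trans (le_of_eq ?_) (Real.rpow_le_rpow (by positivity) h2 (by positivity))
    rw [Real.mul_rpow (by positivity) (by positivity), ← Real.rpow_natCast, ← hndef,
      ← Real.rpow_mul h0, mul_one_div_cancel hn0.ne', Real.rpow_one, one_div n,
      Real.inv_rpow hn0.le]
  · filter_upwards [eventually_ge_atTop 1] with n hn
    obtain ⟨m, rfl⟩ := Nat.exists_eq_add_of_le' hn
    exact ENNReal.rpow_le_one (mPE_blockSeries_le_one hc hN m) (by positivity)

end Blocks

/-- A countable family of nonempty finite blocks exhausts a countably infinite index set. -/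
lemma exists_blockEquiv {N : ℕ → ℕ} (hN : ∀ m, 0 < N m) : Nonempty (ℕ ≃ Σ m, Fin (N m)) := by
  have : Infinite (Σ m, Fin (N m)) :=
    Infinite.of_injective (fun m => (⟨m, ⟨0, hN m⟩⟩ : Σ m, Fin (N m))) fun a b h =>
      congrArg Sigma.fst h
  obtain ⟨d⟩ := nonempty_denumerable (Σ m, Fin (N m))
  exact ⟨(Denumerable.eqv _).symm⟩

/-- **Example 3.8.** For every `1 ≤ p < ∞` there exists an entire function `f : ℓ₁ → ℓ_p`
which is `p`-compact at `0`, whose Taylor polynomials at `0` satisfy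
`limsup κ_p(P_mf(0))^{1/m} = 1` (so `r_p(f, 0) = 1`), but which is not `p`-compact at `e₁`,
the first canonical basis vector of `ℓ₁`. -/
theorem statement11 (p : ℝ) [hp : Fact (1 ≤ p)] :
    ∃ f : lp (fun _ : ℕ => ℂ) 1 → lp (fun _ : ℕ => ℂ) (ENNReal.ofReal p),
      (∀ x, AnalyticAt ℂ f x) ∧
      PCompactAt p f 0 ∧
      Filter.limsup
        (fun m : ℕ => (mPE p (taylorPoly f 0 m '' closedBall 0 1)) ^ (1 / (m : ℝ)))
        Filter.atTop = 1 ∧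
      pRadius p f 0 = 1 ∧
      ¬ PCompactAt p f (lp.single 1 0 (1 : ℂ)) := by
  have hp0 : 0 < p := zero_lt_one.trans_le hp.out
  let N : ℕ → ℕ := fun m => m.factorial ^ ⌈p⌉₊
  let c : ℕ → ℝ := fun m => (N m : ℝ) ^ (-(1 / p))
  have hNpos : ∀ m, 0 < N m := fun m => pow_pos m.factorial_pos _
  obtain ⟨e⟩ := exists_blockEquiv hNpos
  have hc : ∀ m, 0 ≤ c m := fun m => by positivity
  have hN : ∀ m, N m * c m ^ p = 1 := fun m => by
    have h : (0 : ℝ) < N m := by exact_mod_cast hNpos m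
    rw [← Real.rpow_mul h.le, neg_mul, one_div, inv_mul_cancel₀ hp0.ne', Real.rpow_neg_one,
      mul_inv_cancel₀ h.ne']
  have hc' : ∀ m, c m ≤ 1 / (m.factorial : ℝ) := fun m => by
    have hm : (1 : ℝ) ≤ m.factorial := by exact_mod_cast m.factorial_pos
    have hm0 : (0 : ℝ) < m.factorial := by linarith
    have hK : 1 ≤ (⌈p⌉₊ : ℝ) * (1 / p) := by
      rw [mul_one_div, le_div_iff₀ hp0, one_mul]
      exact Nat.le_ceil p
    have h : (m.factorial : ℝ) ≤ (N m : ℝ) ^ (1 / p) := by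
      simp only [N]
      rw [Nat.cast_pow, ← Real.rpow_natCast, ← Real.rpow_mul hm0.le]
      simpa using Real.rpow_le_rpow_of_exponent_le hm hK
    simp only [c]
    rw [Real.rpow_neg (Nat.cast_nonneg _), ← one_div]
    exact one_div_le_one_div_of_le hm0 h
  have htaylor : ∀ n, taylorPoly (blockSeries p e c).sum 0 n =
      fun x => blockSeries p e c n fun _ => x :=
    fun n => funext fun x => taylorPoly_blockSeries_sum hc hc' n x
  have hlim : Filter.limsup (fun m : ℕ =>
      (mPE p (taylorPoly (blockSeries p e c).sum 0 m '' closedBall 0 1)) ^ (1 / (m : ℝ)))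
      Filter.atTop = 1 := by
    simp only [htaylor]
    exact (tendsto_mPE_rpow hc hN).limsup_eq
  refine ⟨(blockSeries p e c).sum, fun x => ?_, pCompactAt_zero_blockSeries_sum hc hc' hN, hlim, ?_,
    not_pCompactAt_single_blockSeries_sum hc hc' hN⟩
  · exact (hasFPowerSeriesOnBall_blockSeries hc hc').analyticAt_of_mem (by simp)
  · rw [pRadius, hlim, inv_one]

end
end

section
/- Let E and F be Banach spaces, 1 ≤ p < ∞, and P : E → F a continuous m-homogeneous polynomial. Then P is p-compact if and only if its transpose P′ : F′ → P(^mE), P′(y′) = y′ ∘ P, is continuous when F′ carries the topology of uniform convergence on p-compact subsets of F and P(^mE) carries its supremum norm topology. -/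
open scoped ENNReal NNReal Classical
open Filter Metric

noncomputable section

variable {E F : Type*} [NormedAddCommGroup E] [NormedSpace ℂ E]
  [NormedAddCommGroup F] [NormedSpace ℂ F]

/-- The `m`-homogeneous polynomial associated to a continuous `m`-linear map. -/
def polyEval {m : ℕ} (A : ContinuousMultilinearMap ℂ (fun _ : Fin m => E) F) (x : E) : F :=
  A fun _ => x

/-- The transpose `P'(y') = y' ∘ P`, viewed as an element of the space of bounded
functions on the closed unit ball of `E` with the supremum norm: this is exactly
`y' ∘ P` regarded in `(P(^mE), ‖·‖)`. -/
def transposeBCF {m : ℕ} (A : ContinuousMultilinearMap ℂ (fun _ : Fin m => E) F)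
    (y' : F →L[ℂ] ℂ) : BoundedContinuousFunction (closedBall (0 : E) 1) ℂ :=
  BoundedContinuousFunction.ofNormedAddCommGroup
    (fun x => y' (polyEval A (x : E)))
    ((y'.continuous.comp (A.cont.comp (continuous_pi fun _ => continuous_id))).comp
      continuous_subtype_val)
    (‖y'‖ * ‖A‖)
    (fun x => by
      have hx : ‖(x : E)‖ ≤ 1 := mem_closedBall_zero_iff.mp x.2
      have h1 : ‖polyEval A (x : E)‖ ≤ ‖A‖ := by
        have h2 := A.le_opNorm fun _ => (x : E)
        have hprod : (∏ _i : Fin m, ‖(x : E)‖) ≤ 1 :=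
          Finset.prod_le_one (fun _ _ => norm_nonneg _) (fun _ _ => hx)
        calc ‖polyEval A (x : E)‖ ≤ ‖A‖ * ∏ _i : Fin m, ‖(x : E)‖ := h2
          _ ≤ ‖A‖ * 1 := mul_le_mul_of_nonneg_left hprod (norm_nonneg _)
          _ = ‖A‖ := mul_one _
      calc ‖y' (polyEval A (x : E))‖ ≤ ‖y'‖ * ‖polyEval A (x : E)‖ := y'.le_opNorm _
        _ ≤ ‖y'‖ * ‖A‖ := mul_le_mul_of_nonneg_left h1 (norm_nonneg _))

open scoped Topology

lemma conjUnitBall_one_iff {α : ℕ → ℂ} : ConjUnitBall 1 α ↔ ∀ n, ‖α n‖ ≤ 1 := by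
  simp [ConjUnitBall]

lemma conjUnitBall_iff_sum_le {p : ℝ} (hp : p ≠ 1) {α : ℕ → ℂ} :
    ConjUnitBall p α ↔ ∀ s : Finset ℕ, ∑ n ∈ s, ‖α n‖ ^ (p / (p - 1)) ≤ 1 := by
  have h0 : ∀ n, 0 ≤ ‖α n‖ ^ (p / (p - 1)) := fun n => by positivity
  rw [ConjUnitBall, if_neg hp]
  constructor
  · rintro ⟨h1, h2⟩ s
    exact (h1.sum_le_tsum s fun i _ => h0 i).trans h2
  · intro h
    exact ⟨summable_of_sum_le h0 h, Real.tsum_le_of_sum_le h0 h⟩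

lemma ConjUnitBall.norm_le_one {p : ℝ} (hp : 1 ≤ p) {α : ℕ → ℂ} (h : ConjUnitBall p α) (n : ℕ) :
    ‖α n‖ ≤ 1 := by
  rcases eq_or_ne p 1 with rfl | hp1
  · exact conjUnitBall_one_iff.1 h n
  · have h1 : 1 < p := lt_of_le_of_ne hp hp1.symm
    have hq : 0 < p / (p - 1) := div_pos (by linarith) (by linarith)
    have := (conjUnitBall_iff_sum_le hp1).1 h {n}
    rw [Finset.sum_singleton] at this
    by_contra! hlt
    exact absurd this (not_le.2 (Real.one_lt_rpow hlt hq))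

lemma ConjUnitBall.comp_injective {p : ℝ} {α : ℕ → ℂ} (h : ConjUnitBall p α) {i : ℕ → ℕ}
    (hi : Function.Injective i) : ConjUnitBall p (α ∘ i) := by
  rcases eq_or_ne p 1 with rfl | hp1
  · exact conjUnitBall_one_iff.2 fun n => conjUnitBall_one_iff.1 h (i n)
  · rw [conjUnitBall_iff_sum_le hp1] at h ⊢
    intro s
    simpa using h (s.map ⟨i, hi⟩)

lemma ConjUnitBall.extend {p : ℝ} (hp : 1 ≤ p) {α : ℕ → ℂ} (h : ConjUnitBall p α) {i : ℕ → ℕ}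
    (hi : Function.Injective i) : ConjUnitBall p (Function.extend i α 0) := by
  rcases eq_or_ne p 1 with rfl | hp1
  · rw [conjUnitBall_one_iff] at h ⊢
    intro n
    by_cases hn : ∃ k, i k = n
    · obtain ⟨k, rfl⟩ := hn
      rw [hi.extend_apply]
      exact h k
    · simp [Function.extend_apply' _ _ _ hn]
  · have h1 : 1 < p := lt_of_le_of_ne hp hp1.symm
    have hq : 0 < p / (p - 1) := div_pos (by linarith) (by linarith)
    have hsupp : ∀ n ∉ Set.range i, ‖Function.extend i α 0 n‖ ^ (p / (p - 1)) = 0 := by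
      intro n hn
      rw [Function.extend_apply' _ _ _ (by simpa using hn)]
      simp [Real.zero_rpow hq.ne']
    have hcomp : (fun n => ‖Function.extend i α 0 n‖ ^ (p / (p - 1))) ∘ i =
        fun n => ‖α n‖ ^ (p / (p - 1)) := by
      ext n
      simp [hi.extend_apply]
    rw [ConjUnitBall, if_neg hp1] at h ⊢
    have hs : HasSum (fun n => ‖Function.extend i α 0 n‖ ^ (p / (p - 1)))
        (∑' n, ‖α n‖ ^ (p / (p - 1))) := by
      rw [← hi.hasSum_iff hsupp, hcomp]
      exact h.1.hasSum
    exact ⟨hs.summable, hs.tsum_eq.trans_le h.2⟩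

lemma ConjUnitBall.mono {p : ℝ} (hp : 1 ≤ p) {α β : ℕ → ℂ} (h : ConjUnitBall p α)
    (hβ : ∀ n, ‖β n‖ ≤ ‖α n‖) : ConjUnitBall p β := by
  rcases eq_or_ne p 1 with rfl | hp1
  · exact conjUnitBall_one_iff.2 fun n => (hβ n).trans (conjUnitBall_one_iff.1 h n)
  · have hq : 0 ≤ p / (p - 1) := div_nonneg (by linarith) (by linarith)
    rw [conjUnitBall_iff_sum_le hp1] at h ⊢
    intro s
    refine le_trans (Finset.sum_le_sum fun n _ => ?_) (h s)
    gcongr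
    exact hβ n

lemma convex_conjUnitBall {p : ℝ} (hp : 1 ≤ p) : Convex ℝ {α : ℕ → ℂ | ConjUnitBall p α} := by
  intro α hα β hβ a b ha hb hab
  simp only [Set.mem_ofPred_eq] at hα hβ ⊢
  have hn : ∀ n, ‖(a • α + b • β) n‖ ≤ a * ‖α n‖ + b * ‖β n‖ := fun n => by
    refine (norm_add_le _ _).trans_eq ?_
    simp [abs_of_nonneg ha, abs_of_nonneg hb]
  rcases eq_or_ne p 1 with rfl | hp1
  · rw [conjUnitBall_one_iff] at *
    intro n
    have h1 := hα n
    have h2 := hβ n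
    refine (hn n).trans ?_
    nlinarith
  · have h1 : 1 < p := lt_of_le_of_ne hp hp1.symm
    have hq : 1 ≤ p / (p - 1) := by rw [le_div_iff₀ (by linarith)]; linarith
    rw [conjUnitBall_iff_sum_le hp1] at *
    intro s
    calc ∑ n ∈ s, ‖(a • α + b • β) n‖ ^ (p / (p - 1))
        ≤ ∑ n ∈ s, (a * ‖α n‖ ^ (p / (p - 1)) + b * ‖β n‖ ^ (p / (p - 1))) := by
          refine Finset.sum_le_sum fun n _ => ?_
          refine (Real.rpow_le_rpow (norm_nonneg _) (hn n) (by linarith)).trans ?_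
          exact (convexOn_rpow hq).2 (Set.mem_Ici.2 (norm_nonneg _))
            (Set.mem_Ici.2 (norm_nonneg _)) ha hb hab
      _ = a * ∑ n ∈ s, ‖α n‖ ^ (p / (p - 1)) + b * ∑ n ∈ s, ‖β n‖ ^ (p / (p - 1)) := by
          rw [Finset.sum_add_distrib, Finset.mul_sum, Finset.mul_sum]
      _ ≤ 1 := by nlinarith [hα s, hβ s]

lemma isCompact_conjUnitBall {p : ℝ} (hp : 1 ≤ p) :
    IsCompact {α : ℕ → ℂ | ConjUnitBall p α} := by
  refine IsCompact.of_isClosed_subset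
    (isCompact_univ_pi fun _ : ℕ => isCompact_closedBall (0 : ℂ) 1) ?_
    fun α hα n _ => by simpa using ConjUnitBall.norm_le_one hp hα n
  rcases eq_or_ne p 1 with rfl | hp1
  · simp only [conjUnitBall_one_iff, Set.ofPred_forall]
    exact isClosed_iInter fun n => isClosed_le (by fun_prop) continuous_const
  · have hq : 0 ≤ p / (p - 1) := div_nonneg (by linarith) (by linarith)
    simp only [conjUnitBall_iff_sum_le hp1, Set.ofPred_forall]
    refine isClosed_iInter fun s => isClosed_le ?_ continuous_const
    exact continuous_finsetSum _ fun n _ =>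
      (continuous_apply n).norm.rpow_const fun _ => Or.inr hq

/-- Hölder's inequality against the closed unit ball of `ℓ_q`. -/
lemma ConjUnitBall.sum_norm_smul_le {p : ℝ} (hp : 1 ≤ p) {α : ℕ → ℂ} (h : ConjUnitBall p α)
    (x : ℕ → F) (s : Finset ℕ) :
    ∑ n ∈ s, ‖α n • x n‖ ≤ (∑ n ∈ s, ‖x n‖ ^ p) ^ (1 / p) := by
  simp only [norm_smul]
  rcases eq_or_ne p 1 with rfl | hp1
  · simp only [Real.rpow_one, div_one]
    exact Finset.sum_le_sum fun n _ =>
      mul_le_of_le_one_left (norm_nonneg _) (conjUnitBall_one_iff.1 h n)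
  · have h1 : 1 < p := lt_of_le_of_ne hp hp1.symm
    have hpq : p.HolderConjugate (p / (p - 1)) := Real.HolderConjugate.conjExponent h1
    refine (Real.inner_le_Lp_mul_Lq_of_nonneg s hpq.symm (fun n _ => norm_nonneg (α n))
      (fun n _ => norm_nonneg (x n))).trans ?_
    refine mul_le_of_le_one_left (by positivity) ?_
    exact Real.rpow_le_one (by positivity) ((conjUnitBall_iff_sum_le hp1).1 h s)
      (one_div_nonneg.2 hpq.symm.nonneg)

lemma ConjUnitBall.sum_norm_smul_le_tsum {p : ℝ} (hp : 1 ≤ p) {α : ℕ → ℂ}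
    (h : ConjUnitBall p α) {x : ℕ → F} (hx : Summable fun n => ‖x n‖ ^ p) (s : Finset ℕ) :
    ∑ n ∈ s, ‖α n • x n‖ ≤ (∑' n, ‖x n‖ ^ p) ^ (1 / p) := by
  refine (h.sum_norm_smul_le hp x s).trans ?_
  refine Real.rpow_le_rpow (by positivity) (hx.sum_le_tsum s fun n _ => by positivity)
    (by positivity)

lemma ConjUnitBall.summable_norm_smul {p : ℝ} (hp : 1 ≤ p) {α : ℕ → ℂ}
    (h : ConjUnitBall p α) {x : ℕ → F} (hx : Summable fun n => ‖x n‖ ^ p) :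
    Summable fun n => ‖α n • x n‖ :=
  summable_of_sum_le (fun _ => norm_nonneg _) (h.sum_norm_smul_le_tsum hp hx)

lemma ConjUnitBall.norm_tsum_smul_le {p : ℝ} (hp : 1 ≤ p) {α : ℕ → ℂ}
    (h : ConjUnitBall p α) {x : ℕ → F} (hx : Summable fun n => ‖x n‖ ^ p) :
    ‖∑' n, α n • x n‖ ≤ (∑' n, ‖x n‖ ^ p) ^ (1 / p) := by
  have hs := h.summable_norm_smul hp hx
  exact (norm_tsum_le_tsum_norm hs).trans
    (hs.tsum_le_of_sum_le (h.sum_norm_smul_le_tsum hp hx))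

lemma pCo_eq_image [CompleteSpace F] {p : ℝ} (hp : 1 ≤ p) {x : ℕ → F}
    (hx : Summable fun n => ‖x n‖ ^ p) :
    pCo p x = (fun α : ℕ → ℂ => ∑' n, α n • x n) '' {α | ConjUnitBall p α} := by
  ext y
  constructor
  · rintro ⟨α, hα, hy⟩
    exact ⟨α, hα, hy.tsum_eq⟩
  · rintro ⟨α, hα, rfl⟩
    exact ⟨α, hα, (ConjUnitBall.summable_norm_smul hp hα hx).of_norm.hasSum⟩

lemma isCompact_pCo [CompleteSpace F] {p : ℝ} (hp : 1 ≤ p) {x : ℕ → F}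
    (hx : Summable fun n => ‖x n‖ ^ p) : IsCompact (pCo p x) := by
  rw [pCo_eq_image hp hx]
  refine (isCompact_conjUnitBall hp).image_of_continuousOn ?_
  have hlim : TendstoUniformlyOn (fun (N : ℕ) (α : ℕ → ℂ) => ∑ n ∈ Finset.range N, α n • x n)
      (fun α => ∑' n, α n • x n) atTop {α | ConjUnitBall p α} := by
    have htail : Tendsto (fun N : ℕ => (∑' n, ‖x (n + N)‖ ^ p) ^ (1 / p)) atTop (𝓝 0) := by
      have h := (tendsto_sum_nat_add fun n => ‖x n‖ ^ p).rpow_const (p := 1 / p)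
        (Or.inr (by positivity))
      rwa [Real.zero_rpow (by positivity)] at h
    rw [Metric.tendstoUniformlyOn_iff]
    intro ε hε
    filter_upwards [htail.eventually_lt_const hε] with N hN α hα
    have hsplit := (ConjUnitBall.summable_norm_smul hp hα hx).of_norm.sum_add_tsum_nat_add N
    rw [← hsplit, dist_eq_norm, add_sub_cancel_left]
    exact ((ConjUnitBall.comp_injective hα (add_left_injective N)).norm_tsum_smul_le hp
      ((summable_nat_add_iff N).2 hx)).trans_lt hN
  refine hlim.continuousOn (Frequently.of_forall fun N => Continuous.continuousOn ?_)
  fun_prop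

lemma convex_pCo {p : ℝ} (hp : 1 ≤ p) (x : ℕ → F) : Convex ℝ (pCo p x) := by
  rintro y ⟨α, hα, hy⟩ z ⟨β, hβ, hz⟩ a b ha hb hab
  refine ⟨a • α + b • β, convex_conjUnitBall hp hα hβ ha hb hab, ?_⟩
  convert (hy.const_smul a).add (hz.const_smul b) using 2 with n
  rw [Pi.add_apply, Pi.smul_apply, Pi.smul_apply, add_smul, smul_assoc, smul_assoc]

lemma smul_mem_pCo {p : ℝ} (hp : 1 ≤ p) {x : ℕ → F} {y : F} (hy : y ∈ pCo p x) {c : ℂ}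
    (hc : ‖c‖ ≤ 1) : c • y ∈ pCo p x := by
  obtain ⟨α, hα, hy⟩ := hy
  refine ⟨fun n => c * α n, hα.mono hp fun n => ?_, ?_⟩
  · rw [norm_mul]
    exact mul_le_of_le_one_left (norm_nonneg _) hc
  · simpa only [mul_smul] using hy.const_smul c

lemma zero_mem_pCo {p : ℝ} (hp : 1 ≤ p) (x : ℕ → F) : (0 : F) ∈ pCo p x := by
  refine ⟨0, ?_, by simp⟩
  rcases eq_or_ne p 1 with rfl | hp1
  · simp [conjUnitBall_one_iff]
  · have hq : p / (p - 1) ≠ 0 := div_ne_zero (by linarith) (sub_ne_zero.2 hp1)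
    simp [conjUnitBall_iff_sum_le hp1, Real.zero_rpow hq]

lemma pCo_const_smul {p : ℝ} (x : ℕ → F) (c : ℂ) {y : F} (hy : y ∈ pCo p x) :
    c • y ∈ pCo p (fun n => c • x n) := by
  obtain ⟨α, hα, hy⟩ := hy
  refine ⟨α, hα, ?_⟩
  simpa only [smul_comm c] using hy.const_smul c

lemma summable_norm_const_smul_rpow {p : ℝ} {x : ℕ → F} (hx : Summable fun n => ‖x n‖ ^ p)
    (c : ℂ) : Summable fun n => ‖c • x n‖ ^ p := by
  simpa only [norm_smul, Real.mul_rpow (norm_nonneg _) (norm_nonneg _)] using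
    hx.mul_left (‖c‖ ^ p)

lemma pCo_comp_subset {p : ℝ} (hp : 1 ≤ p) (x : ℕ → F) {i : ℕ → ℕ} (hi : Function.Injective i) :
    pCo p (x ∘ i) ⊆ pCo p x := by
  rintro y ⟨α, hα, hy⟩
  refine ⟨Function.extend i α 0, hα.extend hp hi, ?_⟩
  rw [← hi.hasSum_iff]
  · convert hy using 2 with n
    simp [hi.extend_apply]
  · intro n hn
    rw [Function.extend_apply' _ _ _ (by simpa using hn)]
    simp

lemma isRelPCompact_empty {p : ℝ} (hp : 1 ≤ p) : IsRelPCompact p (∅ : Set F) :=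
  ⟨0, by simp [Real.zero_rpow (by linarith : p ≠ 0)], Set.empty_subset _⟩

lemma IsRelPCompact.union {p : ℝ} (hp : 1 ≤ p) {K L : Set F} (hK : IsRelPCompact p K)
    (hL : IsRelPCompact p L) : IsRelPCompact p (K ∪ L) := by
  obtain ⟨x, hx, hKx⟩ := hK
  obtain ⟨y, hy, hLy⟩ := hL
  let z : ℕ → F := fun n => if Even n then x (n / 2) else y (n / 2)
  have hze : ∀ n, z (2 * n) = x n := fun n => by simp [z]
  have hzo : ∀ n, z (2 * n + 1) = y n := fun n => by
    have : (2 * n + 1) / 2 = n := by omega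
    simp [z, this]
  have hxz : x = z ∘ fun n => 2 * n := (funext hze).symm
  have hyz : y = z ∘ fun n => 2 * n + 1 := (funext hzo).symm
  refine ⟨z, ?_, Set.union_subset (hKx.trans ?_) (hLy.trans ?_)⟩
  · refine (HasSum.even_add_odd (m := ∑' n, ‖x n‖ ^ p) (m' := ∑' n, ‖y n‖ ^ p) ?_ ?_).summable
    · simpa only [hze] using hx.hasSum
    · simpa only [hzo] using hy.hasSum
  · rw [hxz]
    exact pCo_comp_subset hp z fun a b h => by simpa using h
  · rw [hyz]
    exact pCo_comp_subset hp z fun a b h => by simpa using h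

/-- Bipolar-type separation of a point from an absolutely convex closed set `p-co{x_n}`. -/
lemma exists_dual_of_notMem_pCo [CompleteSpace F] {p : ℝ} (hp : 1 ≤ p) {x : ℕ → F}
    (hx : Summable fun n => ‖x n‖ ^ p) {y : F} (hy : y ∉ pCo p x) :
    ∃ g : F →L[ℂ] ℂ, (∀ k ∈ pCo p x, ‖g k‖ < 1) ∧ 1 < ‖g y‖ := by
  obtain ⟨f, u, hfu, huy⟩ := RCLike.geometric_hahn_banach_closed_point (𝕜 := ℂ)
    (convex_pCo hp x) (isCompact_pCo hp hx).isClosed hy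
  have hu : 0 < u := by simpa using hfu 0 (zero_mem_pCo hp x)
  refine ⟨(u⁻¹ : ℂ) • f, fun k hk => ?_, ?_⟩
  · obtain ⟨c, hc, hck⟩ := RCLike.exists_norm_eq_mul_self (f k)
    have h1 := hfu (c • k) (smul_mem_pCo hp hk hc.le)
    rw [map_smul, smul_eq_mul, ← hck] at h1
    have h2 : ‖f k‖ < u := by simpa using h1
    simpa [abs_of_pos hu, inv_mul_lt_iff₀ hu] using h2
  · have h2 : u < ‖f y‖ := huy.trans_le (RCLike.re_le_norm _)
    simpa [abs_of_pos hu, lt_inv_mul_iff₀ hu] using h2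

lemma transposeBCF_apply {m : ℕ} (A : ContinuousMultilinearMap ℂ (fun _ : Fin m => E) F)
    (y' : F →L[ℂ] ℂ) (x : closedBall (0 : E) 1) :
    transposeBCF A y' x = y' (polyEval A (x : E)) := rfl

/-- The transpose as an additive map on the dual with the topology of uniform convergence on a
family of sets. -/
def transposeAddHom {m : ℕ} (A : ContinuousMultilinearMap ℂ (fun _ : Fin m => E) F)
    (S : Set (Set F)) :
    UniformConvergenceCLM (RingHom.id ℂ) ℂ S →+
      BoundedContinuousFunction (closedBall (0 : E) 1) ℂ where
  toFun y' := transposeBCF A y'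
  map_zero' := by ext x; rfl
  map_add' _ _ := by ext x; rfl

/-- **Proposition 4.1 ((i) ⇔ (ii)).** Let `E`, `F` be Banach spaces, `1 ≤ p < ∞`, and
`P : E → F` a continuous `m`-homogeneous polynomial.  Then `P` is `p`-compact if and only
if its transpose `P' : F'_{cp} → (P(^mE), ‖·‖)` is continuous, where `F'` carries the
topology of uniform convergence on `p`-compact subsets of `F` and `P(^mE)` the supremum
norm (realized isometrically inside the bounded functions on the unit ball of `E`). -/
theorem statement12 [CompleteSpace E] [CompleteSpace F] (p : ℝ) (hp : 1 ≤ p)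
    (m : ℕ) (A : ContinuousMultilinearMap ℂ (fun _ : Fin m => E) F)
    (hsym : ∀ (v : Fin m → E) (σ : Equiv.Perm (Fin m)), A (v ∘ σ) = A v) :
    IsRelPCompact p (polyEval A '' closedBall 0 1) ↔
      @Continuous (F →L[ℂ] ℂ) (BoundedContinuousFunction (closedBall (0 : E) 1) ℂ)
        (UniformConvergenceCLM.instTopologicalSpace (RingHom.id ℂ) ℂ
          {K : Set F | IsRelPCompact p K})
        inferInstance
        (fun y' => transposeBCF A y') := by
  set S : Set (Set F) := {K : Set F | IsRelPCompact p K} with hS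
  change _ ↔ Continuous (transposeAddHom A S)
  constructor
  · intro hP
    refine continuous_of_continuousAt_zero (transposeAddHom A S) ?_
    rw [ContinuousAt, map_zero, Metric.tendsto_nhds]
    intro ε hε
    filter_upwards [UniformConvergenceCLM.eventually_nhds_zero_mapsTo (RingHom.id ℂ)
      (𝔖 := S) hP (Metric.ball_mem_nhds (0 : ℂ) (half_pos hε))] with y' hy'
    refine lt_of_le_of_lt ?_ (half_lt_self hε)
    refine (BoundedContinuousFunction.dist_le (half_pos hε).le).2 fun x => ?_
    exact (hy' ⟨x, x.2, rfl⟩ : y' (polyEval A (x : E)) ∈ ball (0 : ℂ) (ε / 2)).le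
  · intro hc
    have hdir : DirectedOn (· ⊆ ·) S := fun K hK L hL =>
      ⟨K ∪ L, IsRelPCompact.union hp hK hL, Set.subset_union_left, Set.subset_union_right⟩
    have hbasis := UniformConvergenceCLM.hasBasis_nhds_zero_of_basis (RingHom.id ℂ) ℂ S
      ⟨∅, isRelPCompact_empty hp⟩ hdir (Metric.nhds_basis_ball (x := (0 : ℂ)))
    have hnhds : transposeAddHom A S ⁻¹' closedBall 0 1 ∈ 𝓝 0 :=
      hc.continuousAt.preimage_mem_nhds
        (by rw [map_zero]; exact closedBall_mem_nhds _ one_pos)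
    obtain ⟨⟨K, ε⟩, ⟨⟨x, hx, hKx⟩, hε⟩, hsub⟩ := hbasis.mem_iff.1 hnhds
    dsimp only at hKx hε hsub
    have hεC : (ε : ℂ) ≠ 0 := by exact_mod_cast hε.ne'
    have hx' := summable_norm_const_smul_rpow hx (ε⁻¹ : ℂ)
    refine ⟨fun n => (ε⁻¹ : ℂ) • x n, hx', ?_⟩
    rintro _ ⟨e, he, rfl⟩
    by_contra hmem
    obtain ⟨g, hg, hgy⟩ := exists_dual_of_notMem_pCo hp hx' hmem
    have hgK : g ∈ transposeAddHom A S ⁻¹' closedBall 0 1 := by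
      refine hsub fun k hk => ?_
      have h1 := hg _ (pCo_const_smul x (ε⁻¹ : ℂ) (hKx hk))
      rw [map_smul, norm_smul, norm_inv, Complex.norm_real, Real.norm_of_nonneg hε.le,
        inv_mul_lt_iff₀ hε, mul_one] at h1
      exact mem_ball_zero_iff.2 h1
    have h2 := (BoundedContinuousFunction.norm_coe_le_norm (transposeAddHom A S g) ⟨e, he⟩).trans
      (mem_closedBall_zero_iff.1 hgK)
    exact absurd h2 (not_le.2 hgy)

end
end
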